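/- arXiv:1212.4048 — 2 statements merged into one kernel-verified Lean document; each statement's English description precedes it below -/
import Mathlib

section
/- For real numbers a < b and t with t + a > 0, (1/(2π)) ∫_a^b log(x+t)/((x+t)√((b-x)(x-a))) dx = -(1/√((t+a)(t+b))) · log(1/(2√(t+a)) + 1/(2√(t+b))). -/
theorem integral_log_add_mul_cos {A B : ℝ} (hB : 0 < B) (hBA : B < A) :
    ∫ θ in (0 : ℝ)..Real.pi, Real.log (A ^ 2 + B ^ 2 + 2 * A * B * Real.cos θ) =
      2 * Real.pi * Real.log A := by
  have hA : 0 < A := hB.trans hBA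
  have hpos : ∀ θ : ℝ, 0 < A ^ 2 + B ^ 2 + 2 * A * B * Real.cos θ := fun θ => by
    nlinarith [mul_pos hA hB, Real.neg_one_le_cos θ, sq_pos_of_pos (sub_pos.2 hBA)]
  set f : ℝ → ℝ := fun θ => Real.log (A ^ 2 + B ^ 2 + 2 * A * B * Real.cos θ) with hf
  have hcont : Continuous f :=
    Continuous.log (by fun_prop) fun θ => (hpos θ).ne'
  have hnorm : ∀ θ : ℝ, Real.log ‖circleMap 0 B θ - (-A : ℂ)‖ = f θ / 2 := by
    intro θ
    have hsq : ‖circleMap 0 B θ - (-A : ℂ)‖ ^ 2 =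
        A ^ 2 + B ^ 2 + 2 * A * B * Real.cos θ := by
      rw [← Complex.normSq_eq_norm_sq, Complex.normSq_apply, circleMap_zero,
        Complex.exp_mul_I, ← Complex.ofReal_cos, ← Complex.ofReal_sin]
      simp [Complex.cos_ofReal_re, Complex.sin_ofReal_re]
      linear_combination B ^ 2 * Real.sin_sq_add_cos_sq θ
    rw [hf]
    simp only
    rw [← hsq, Real.log_pow]
    push_cast
    ring
  have havg := circleAverage_log_norm_sub_const_eq_log_radius_add_posLog
    (c := 0) (a := (-A : ℂ)) hB.ne'
  rw [Real.circleAverage_def] at havg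
  simp only [hnorm, intervalIntegral.integral_div, smul_eq_mul] at havg
  have hlog : Real.log B + Real.posLog (B⁻¹ * ‖(0 : ℂ) - -A‖) = Real.log A := by
    have h1 : ‖(0 : ℂ) - -A‖ = A := by simp [abs_of_pos hA]
    rw [h1, Real.posLog_eq_log, Real.log_mul (by positivity) hA.ne', Real.log_inv]
    · ring
    · rw [abs_of_pos (by positivity), ← div_eq_inv_mul, one_le_div hB]
      exact hBA.le
  rw [hlog] at havg
  have hrefl : ∫ θ in Real.pi..(2 * Real.pi), f θ = ∫ θ in (0 : ℝ)..Real.pi, f θ := by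
    have h := intervalIntegral.integral_comp_sub_left (a := 0) (b := Real.pi) f (2 * Real.pi)
    have h2 : ∀ θ, f (2 * Real.pi - θ) = f θ := fun θ => by
      simp [hf, Real.cos_two_pi_sub]
    simp only [h2] at h
    rw [h]
    congr 1 <;> ring
  rw [← intervalIntegral.integral_add_adjacent_intervals
    (hcont.intervalIntegrable 0 Real.pi) (hcont.intervalIntegrable Real.pi (2 * Real.pi)),
    hrefl] at havg
  rw [← havg]
  field_simp
  ring

theorem setIntegral_log_div_mul_sqrt {p q t : ℝ} (hp : 0 < p) (hpq : p < q) :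
    ∫ x in Set.Ioo (p - t) (q - t),
        Real.log (x + t) / ((x + t) * Real.sqrt ((q - t - x) * (x - (p - t)))) =
      ∫ θ in Set.Ioo 0 Real.pi,
        Real.log (p * q / ((p + q) / 2 + (q - p) / 2 * Real.cos θ)) / Real.sqrt (p * q) := by
  have hq : 0 < q := hp.trans hpq
  set z : ℝ → ℝ := fun θ => (p + q) / 2 + (q - p) / 2 * Real.cos θ with hz
  have hzpos : ∀ θ, 0 < z θ := fun θ => by
    simp only [hz]
    nlinarith [Real.neg_one_le_cos θ]
  have hzder : ∀ θ, HasDerivAt z ((q - p) / 2 * -Real.sin θ) θ := fun θ =>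
    ((Real.hasDerivAt_cos θ).const_mul _).const_add _
  have hder : ∀ θ, HasDerivAt (fun θ => p * q / z θ - t)
      (p * q * ((q - p) / 2 * Real.sin θ) / z θ ^ 2) θ := fun θ => by
    refine (((hasDerivAt_const θ (p * q)).div (hzder θ) (hzpos θ).ne').sub_const t).congr_deriv ?_
    ring
  have hinj : Set.InjOn (fun θ => p * q / z θ - t) (Set.Ioo 0 Real.pi) := by
    intro θ hθ φ hφ h
    have h1 : z θ = z φ := by
      have h2 : p * q / z θ = p * q / z φ := by simpa using h
      rw [div_eq_div_iff (hzpos θ).ne' (hzpos φ).ne'] at h2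
      exact (mul_left_cancel₀ (mul_pos hp hq).ne' h2).symm
    have h3 : Real.cos θ = Real.cos φ := by
      have h4 : (q - p) / 2 * Real.cos θ = (q - p) / 2 * Real.cos φ := by
        simpa [hz] using h1
      exact mul_left_cancel₀ (by linarith : (0 : ℝ) < (q - p) / 2).ne' h4
    exact Real.injOn_cos (Set.Ioo_subset_Icc_self hθ) (Set.Ioo_subset_Icc_self hφ) h3
  have hzlt : ∀ θ ∈ Set.Ioo 0 Real.pi, p < z θ ∧ z θ < q := by
    intro θ hθ
    have hc1 : Real.cos θ < 1 := by
      simpa using Real.cos_lt_cos_of_nonneg_of_le_pi le_rfl hθ.2.le hθ.1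
    have hc2 : -1 < Real.cos θ := by
      simpa using Real.cos_lt_cos_of_nonneg_of_le_pi hθ.1.le le_rfl hθ.2
    constructor <;> simp only [hz] <;> nlinarith
  have himg : (fun θ => p * q / z θ - t) '' Set.Ioo 0 Real.pi = Set.Ioo (p - t) (q - t) := by
    ext x
    constructor
    · rintro ⟨θ, hθ, rfl⟩
      obtain ⟨h1, h2⟩ := hzlt θ hθ
      refine ⟨sub_lt_sub_right ?_ _, sub_lt_sub_right ?_ _⟩
      · rw [lt_div_iff₀ (hzpos θ)]
        exact mul_lt_mul_of_pos_left h2 hp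
      · rw [div_lt_iff₀ (hzpos θ), mul_comm p q]
        exact mul_lt_mul_of_pos_left h1 hq
    · rintro ⟨h1, h2⟩
      have hx : 0 < x + t := by linarith
      have hw1 : p < p * q / (x + t) := by
        rw [lt_div_iff₀ hx]
        exact mul_lt_mul_of_pos_left (by linarith) hp
      have hw2 : p * q / (x + t) < q := by
        rw [div_lt_iff₀ hx, mul_comm p q]
        exact mul_lt_mul_of_pos_left (by linarith) hq
      have hr : 0 < (q - p) / 2 := by linarith
      set c := (p * q / (x + t) - (p + q) / 2) / ((q - p) / 2) with hc
      have hc1 : -1 < c := by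
        rw [hc, lt_div_iff₀ hr]
        linarith
      have hc2 : c < 1 := by
        rw [hc, div_lt_iff₀ hr]
        linarith
      refine ⟨Real.arccos c, ⟨Real.arccos_pos.2 hc2, ?_⟩, ?_⟩
      · refine lt_of_le_of_ne (Real.arccos_le_pi c) fun h => ?_
        exact absurd (Real.arccos_eq_pi.1 h) (not_le.2 hc1)
      · have hzc : z (Real.arccos c) = p * q / (x + t) := by
          simp only [hz]
          rw [Real.cos_arccos hc1.le hc2.le, hc, mul_div_cancel₀ _ hr.ne']
          ring
        simp only [hzc]
        rw [div_div_cancel₀ (mul_pos hp hq).ne']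
        ring
  rw [← himg, MeasureTheory.integral_image_eq_integral_abs_deriv_smul measurableSet_Ioo
    (fun θ _ => (hder θ).hasDerivWithinAt) hinj]
  refine MeasureTheory.setIntegral_congr_fun measurableSet_Ioo fun θ hθ => ?_
  have hs : 0 < Real.sin θ := Real.sin_pos_of_mem_Ioo hθ
  have hzθ := hzpos θ
  have hr : 0 < (q - p) / 2 := by linarith
  have hsq : (q - t - (p * q / z θ - t)) * (p * q / z θ - t - (p - t)) =
      p * q * (((q - p) / 2 * Real.sin θ) / z θ) ^ 2 := by
    have h : ((q - p) / 2 * Real.sin θ) ^ 2 = (z θ - p) * (q - z θ) := by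
      simp only [hz]
      rw [mul_pow, Real.sin_sq]
      ring
    rw [div_pow, h]
    field_simp
    ring
  have hd : 0 < p * q * ((q - p) / 2 * Real.sin θ) / z θ ^ 2 := by positivity
  simp only [smul_eq_mul]
  rw [hsq, Real.sqrt_mul (by positivity), Real.sqrt_sq (by positivity), abs_of_pos hd,
    sub_add_cancel]
  have hne : q - p ≠ 0 := by linarith
  have hsqrt : Real.sqrt (p * q) ≠ 0 := (Real.sqrt_pos.2 (mul_pos hp hq)).ne'
  generalize Real.log (p * q / z θ) = L
  field_simp

theorem stmt_4 (a b t : ℝ) (hab : a < b) (hta : 0 < t + a) :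
    (1 / (2 * Real.pi)) *
        ∫ x in Set.Ioo a b, Real.log (x + t) / ((x + t) * Real.sqrt ((b - x) * (x - a)))
      = -(1 / Real.sqrt ((t + a) * (t + b))) *
          Real.log (1 / (2 * Real.sqrt (t + a)) + 1 / (2 * Real.sqrt (t + b))) := by
  have hint := setIntegral_log_div_mul_sqrt (t := t) hta (show t + a < t + b by linarith)
  simp only [add_sub_cancel_left] at hint
  rw [hint]
  have htb : 0 < t + b := by linarith
  have hp : 0 < Real.sqrt (t + a) := Real.sqrt_pos.2 hta
  have hq : 0 < Real.sqrt (t + b) := Real.sqrt_pos.2 htb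
  have hpq : Real.sqrt (t + a) < Real.sqrt (t + b) := Real.sqrt_lt_sqrt hta.le (by linarith)
  have hlog := integral_log_add_mul_cos
    (A := (Real.sqrt (t + b) + Real.sqrt (t + a)) / 2)
    (B := (Real.sqrt (t + b) - Real.sqrt (t + a)) / 2) (by linarith) (by linarith)
  have hz : ∀ θ, ((Real.sqrt (t + b) + Real.sqrt (t + a)) / 2) ^ 2 +
      ((Real.sqrt (t + b) - Real.sqrt (t + a)) / 2) ^ 2 +
      2 * ((Real.sqrt (t + b) + Real.sqrt (t + a)) / 2) *
        ((Real.sqrt (t + b) - Real.sqrt (t + a)) / 2) * Real.cos θ =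
      (t + a + (t + b)) / 2 + (t + b - (t + a)) / 2 * Real.cos θ := fun θ => by
    linear_combination (1 / 2 - Real.cos θ / 2) * Real.sq_sqrt hta.le +
      (1 / 2 + Real.cos θ / 2) * Real.sq_sqrt htb.le
  simp only [hz] at hlog
  have hzpos : ∀ θ, 0 < (t + a + (t + b)) / 2 + (t + b - (t + a)) / 2 * Real.cos θ :=
    fun θ => by nlinarith [Real.neg_one_le_cos θ]
  have hcont : Continuous fun θ =>
      Real.log ((t + a + (t + b)) / 2 + (t + b - (t + a)) / 2 * Real.cos θ) :=
    Continuous.log (by fun_prop) fun θ => (hzpos θ).ne'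
  rw [← MeasureTheory.integral_Ioc_eq_integral_Ioo,
    ← intervalIntegral.integral_of_le Real.pi_pos.le, intervalIntegral.integral_div]
  simp only [fun θ => Real.log_div (mul_pos hta htb).ne' (hzpos θ).ne']
  rw [intervalIntegral.integral_sub (by simp) (hcont.intervalIntegrable _ _), hlog,
    intervalIntegral.integral_const]
  have harg : 1 / (2 * Real.sqrt (t + a)) + 1 / (2 * Real.sqrt (t + b)) =
      (Real.sqrt (t + b) + Real.sqrt (t + a)) / 2 / Real.sqrt ((t + a) * (t + b)) := by
    rw [Real.sqrt_mul hta.le]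
    field_simp
  have hs : 0 < Real.sqrt ((t + a) * (t + b)) := Real.sqrt_pos.2 (mul_pos hta htb)
  rw [harg, Real.log_div (by positivity) hs.ne', Real.log_sqrt (mul_pos hta htb).le]
  have hpi := Real.pi_pos
  simp only [smul_eq_mul, sub_zero]
  field_simp
  ring
end

section
/- For real numbers 0 < a < b and t with t + a > 0, (1/(2π)) ∫_a^b log(x+t)/(x·√((b-x)(x-a))) dx = (1/(2√(ab)))·log(((√(ab)+W(t))² - t²)/(√a+√b)²), where W(t) = √((t+a)(t+b)). -/
open MeasureTheory in
theorem integral_log_sq_add_sq_cos {p q : ℝ} (hp : 0 < p) (hq : 0 < q) :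
    ∫ θ in (0 : ℝ)..Real.pi,
        Real.log ((p ^ 2 + q ^ 2) / 2 + (p ^ 2 - q ^ 2) / 2 * Real.cos θ)
      = 2 * Real.pi * Real.log ((p + q) / 2) := by
  set f : ℝ → ℝ := fun θ =>
    Real.log ((p ^ 2 + q ^ 2) / 2 + (p ^ 2 - q ^ 2) / 2 * Real.cos θ) with hf
  have pos (θ : ℝ) : 0 < (p ^ 2 + q ^ 2) / 2 + (p ^ 2 - q ^ 2) / 2 * Real.cos θ := by
    have hp2 : 0 < p ^ 2 := by positivity
    have hq2 : 0 < q ^ 2 := by positivity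
    rcases lt_or_ge 0 (Real.cos θ) with h | h
    · nlinarith [Real.cos_le_one θ]
    · nlinarith [Real.neg_one_le_cos θ]
  have hcont : Continuous f :=
    Continuous.log (by fun_prop) fun θ => (pos θ).ne'
  have hnorm (θ : ℝ) :
      Real.log ‖circleMap (((p + q) / 2 : ℝ) : ℂ) ((p - q) / 2) θ‖ = f θ / 2 := by
    have h : ‖circleMap (((p + q) / 2 : ℝ) : ℂ) ((p - q) / 2) θ‖ ^ 2
        = (p ^ 2 + q ^ 2) / 2 + (p ^ 2 - q ^ 2) / 2 * Real.cos θ := by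
      have hmap : circleMap (((p + q) / 2 : ℝ) : ℂ) ((p - q) / 2) θ
          = (((p + q) / 2 + (p - q) / 2 * Real.cos θ : ℝ) : ℂ)
            + (((p - q) / 2 * Real.sin θ : ℝ) : ℂ) * Complex.I := by
        rw [circleMap, Complex.exp_mul_I]
        push_cast
        ring
      rw [Complex.sq_norm, hmap, Complex.normSq_add_mul_I]
      linear_combination ((p - q) / 2) ^ 2 * Real.sin_sq_add_cos_sq θ
    rw [hf]
    dsimp only
    rw [← h, Real.log_pow]
    push_cast
    ring
  have havg : Real.circleAverage (fun z : ℂ => Real.log ‖z‖)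
      (((p + q) / 2 : ℝ) : ℂ) ((p - q) / 2) = Real.log ((p + q) / 2) := by
    rw [InnerProductSpace.HarmonicOnNhd.circleAverage_eq]
    · rw [Complex.norm_real, Real.norm_of_nonneg (by positivity)]
    · intro x hx
      refine AnalyticAt.harmonicAt_log_norm (f := fun z : ℂ => z) (by fun_prop) ?_
      rintro rfl
      rw [Metric.mem_closedBall, dist_zero_left, Complex.norm_real,
        Real.norm_of_nonneg (by positivity)] at hx
      have : |(p - q) / 2| < (p + q) / 2 := abs_lt.2 ⟨by linarith, by linarith⟩
      linarith
  have hfull : ∫ θ in (0 : ℝ)..2 * Real.pi, f θ = 4 * Real.pi * Real.log ((p + q) / 2) := by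
    rw [Real.circleAverage_def] at havg
    simp only [hnorm, intervalIntegral.integral_div, smul_eq_mul] at havg
    rw [← havg]
    have := Real.pi_pos.ne'
    field_simp
    ring
  have hsymm : ∫ θ in Real.pi..2 * Real.pi, f θ = ∫ θ in (0 : ℝ)..Real.pi, f θ := by
    have h := intervalIntegral.integral_comp_sub_left (a := 0) (b := Real.pi) f (2 * Real.pi)
    rw [sub_zero, show 2 * Real.pi - Real.pi = Real.pi by ring] at h
    rw [← h]
    simp only [hf, Real.cos_two_pi_sub]
  have hsplit := intervalIntegral.integral_add_adjacent_intervals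
    (hcont.intervalIntegrable (μ := volume) 0 Real.pi)
    (hcont.intervalIntegrable (μ := volume) Real.pi (2 * Real.pi))
  linarith

/-- The substitution `x = ab / y` with `y = (a + b) / 2 + (b - a) / 2 * cos θ`. -/
theorem setIntegral_div_mul_sqrt_eq_integral_cos {a b : ℝ} (ha : 0 < a) (hab : a < b)
    (g : ℝ → ℝ) :
    ∫ x in Set.Ioo a b, g x / (x * Real.sqrt ((b - x) * (x - a)))
      = ∫ θ in (0 : ℝ)..Real.pi,
          g (a * b / ((a + b) / 2 + (b - a) / 2 * Real.cos θ)) / Real.sqrt (a * b) := by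
  have hb : 0 < b := ha.trans hab
  set y : ℝ → ℝ := fun θ => (a + b) / 2 + (b - a) / 2 * Real.cos θ with hy
  have cos_bounds {θ : ℝ} (hθ : θ ∈ Set.Ioo 0 Real.pi) : -1 < Real.cos θ ∧ Real.cos θ < 1 := by
    have hs := Real.sin_pos_of_mem_Ioo hθ
    have := Real.sin_sq_add_cos_sq θ
    constructor <;> nlinarith
  have hya {θ : ℝ} (hθ : θ ∈ Set.Ioo 0 Real.pi) : a < y θ := by
    have := cos_bounds hθ
    simp only [hy]
    nlinarith
  have hyb {θ : ℝ} (hθ : θ ∈ Set.Ioo 0 Real.pi) : y θ < b := by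
    have := cos_bounds hθ
    simp only [hy]
    nlinarith
  have himage : (fun θ => a * b / y θ) '' Set.Ioo 0 Real.pi = Set.Ioo a b := by
    ext x
    constructor
    · rintro ⟨θ, hθ, rfl⟩
      have h1 := hya hθ
      have h2 := hyb hθ
      have h3 := ha.trans h1
      constructor
      · rw [lt_div_iff₀ h3]
        nlinarith
      · rw [div_lt_iff₀ h3]
        nlinarith
    · rintro ⟨h1, h2⟩
      have hx : 0 < x := ha.trans h1
      have hba : 0 < (b - a) / 2 := by linarith
      have h3 : a < a * b / x := by
        rw [lt_div_iff₀ hx]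
        nlinarith
      have h4 : a * b / x < b := by
        rw [div_lt_iff₀ hx]
        nlinarith
      have h5 : -1 < (a * b / x - (a + b) / 2) / ((b - a) / 2) := by
        rw [lt_div_iff₀ hba]
        linarith
      have h6 : (a * b / x - (a + b) / 2) / ((b - a) / 2) < 1 := by
        rw [div_lt_iff₀ hba]
        linarith
      refine ⟨Real.arccos ((a * b / x - (a + b) / 2) / ((b - a) / 2)),
        ⟨Real.arccos_pos.2 h6, ?_⟩, ?_⟩
      · refine lt_of_le_of_ne (Real.arccos_le_pi _) fun h => ?_
        exact absurd (Real.arccos_eq_pi.1 h) (not_le.2 h5)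
      · simp only [hy]
        rw [Real.cos_arccos h5.le h6.le, mul_div_cancel₀ _ hba.ne']
        have : a * b ≠ 0 := by positivity
        rw [add_sub_cancel, div_div_cancel₀ this]
  have hinj : Set.InjOn (fun θ => a * b / y θ) (Set.Ioo 0 Real.pi) := by
    intro θ hθ φ hφ h
    have h1 := ha.trans (hya hθ)
    have h2 := ha.trans (hya hφ)
    have hy' : y θ = y φ := by
      have : a * b ≠ 0 := by positivity
      exact (mul_left_cancel₀ this ((div_eq_div_iff h1.ne' h2.ne').1 h)).symm
    refine Real.injOn_cos ⟨hθ.1.le, hθ.2.le⟩ ⟨hφ.1.le, hφ.2.le⟩ ?_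
    have hba : (b - a) / 2 ≠ 0 := by linarith
    exact mul_left_cancel₀ hba (add_left_cancel hy')
  have hderiv : ∀ θ ∈ Set.Ioo 0 Real.pi, HasDerivWithinAt (fun θ => a * b / y θ)
      (a * b * ((b - a) / 2 * Real.sin θ) / y θ ^ 2) (Set.Ioo 0 Real.pi) θ := by
    intro θ hθ
    have hyd : HasDerivAt y ((b - a) / 2 * -Real.sin θ) θ :=
      ((Real.hasDerivAt_cos θ).const_mul _).const_add _
    exact (((hasDerivAt_const θ (a * b)).div hyd (ha.trans (hya hθ)).ne').congr_deriv
      (by ring)).hasDerivWithinAt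
  rw [intervalIntegral.integral_of_le Real.pi_pos.le,
    MeasureTheory.integral_Ioc_eq_integral_Ioo, ← himage,
    MeasureTheory.integral_image_eq_integral_abs_deriv_smul measurableSet_Ioo hderiv hinj]
  refine MeasureTheory.setIntegral_congr_fun measurableSet_Ioo fun θ hθ => ?_
  have hs := Real.sin_pos_of_mem_Ioo hθ
  have hy0 := ha.trans (hya hθ)
  have hr : 0 < (b - a) / 2 * Real.sin θ := mul_pos (by linarith) hs
  have hab0 : 0 < Real.sqrt (a * b) := by positivity
  have hsqrt : Real.sqrt ((b - a * b / y θ) * (a * b / y θ - a))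
      = Real.sqrt (a * b) * ((b - a) / 2 * Real.sin θ) / y θ := by
    rw [Real.sqrt_eq_iff_mul_self_eq_of_pos (by positivity)]
    have h : (y θ - a) * (b - y θ) = ((b - a) / 2 * Real.sin θ) ^ 2 := by
      simp only [hy]
      linear_combination -((b - a) / 2) ^ 2 * Real.sin_sq_add_cos_sq θ
    field_simp
    rw [Real.sq_sqrt (by positivity)]
    linear_combination (-4 * a * b) * h
  change _ = g (a * b / y θ) / Real.sqrt (a * b)
  rw [hsqrt, abs_of_pos (by positivity), smul_eq_mul]
  have hr' : b - a ≠ 0 := by linarith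
  field_simp

theorem stmt_6 (a b t : ℝ) (ha : 0 < a) (hab : a < b) (hta : 0 < t + a) :
    (1 / (2 * Real.pi)) *
        ∫ x in Set.Ioo a b, Real.log (x + t) / (x * Real.sqrt ((b - x) * (x - a)))
      = (1 / (2 * Real.sqrt (a * b))) *
          Real.log (((Real.sqrt (a * b) + Real.sqrt ((t + a) * (t + b))) ^ 2 - t ^ 2) /
            (Real.sqrt a + Real.sqrt b) ^ 2) := by
  have hb : 0 < b := ha.trans hab
  have htb : 0 < t + b := by linarith
  have hab0 : 0 < a * b := by positivity
  have hya (θ : ℝ) : a ≤ (a + b) / 2 + (b - a) / 2 * Real.cos θ := by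
    nlinarith [Real.neg_one_le_cos θ]
  have hyb (θ : ℝ) : (a + b) / 2 + (b - a) / 2 * Real.cos θ ≤ b := by
    nlinarith [Real.cos_le_one θ]
  have hpos (θ : ℝ) :
      0 < a * b + t * ((a + b) / 2 + (b - a) / 2 * Real.cos θ) := by
    rcases le_or_gt 0 t with ht | ht
    · have := mul_nonneg ht (ha.le.trans (hya θ))
      linarith
    · nlinarith [hyb θ]
  have hlog (θ : ℝ) :
      Real.log (a * b / ((a + b) / 2 + (b - a) / 2 * Real.cos θ) + t)
        = Real.log (a * b + t * ((a + b) / 2 + (b - a) / 2 * Real.cos θ))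
          - Real.log ((a + b) / 2 + (b - a) / 2 * Real.cos θ) := by
    have hy := ha.trans_le (hya θ)
    rw [← Real.log_div (hpos θ).ne' hy.ne', add_div (a * b),
      mul_div_cancel_right₀ _ hy.ne']
  have hden : ∫ θ in (0 : ℝ)..Real.pi, Real.log ((a + b) / 2 + (b - a) / 2 * Real.cos θ)
      = 2 * Real.pi * Real.log ((Real.sqrt b + Real.sqrt a) / 2) := by
    rw [← integral_log_sq_add_sq_cos (Real.sqrt_pos.2 hb) (Real.sqrt_pos.2 ha),
      Real.sq_sqrt hb.le, Real.sq_sqrt ha.le, add_comm b a]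
  have hnum : ∫ θ in (0 : ℝ)..Real.pi,
        Real.log (a * b + t * ((a + b) / 2 + (b - a) / 2 * Real.cos θ))
      = 2 * Real.pi * Real.log ((Real.sqrt (b * (t + a)) + Real.sqrt (a * (t + b))) / 2) := by
    rw [← integral_log_sq_add_sq_cos (Real.sqrt_pos.2 (by positivity))
      (Real.sqrt_pos.2 (by positivity)), Real.sq_sqrt (by positivity),
      Real.sq_sqrt (by positivity)]
    congr 1 with θ
    congr 1
    ring
  rw [setIntegral_div_mul_sqrt_eq_integral_cos ha hab fun x => Real.log (x + t)]
  simp only [hlog]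
  rw [intervalIntegral.integral_div, intervalIntegral.integral_sub, hden, hnum]
  · have hu : 0 < Real.sqrt (b * (t + a)) + Real.sqrt (a * (t + b)) := by positivity
    have hv : 0 < Real.sqrt a + Real.sqrt b := by positivity
    have hsq : (Real.sqrt (a * b) + Real.sqrt ((t + a) * (t + b))) ^ 2 - t ^ 2
        = (Real.sqrt (b * (t + a)) + Real.sqrt (a * (t + b))) ^ 2 := by
      have hcross : Real.sqrt (b * (t + a)) * Real.sqrt (a * (t + b))
          = Real.sqrt (a * b) * Real.sqrt ((t + a) * (t + b)) := by
        rw [← Real.sqrt_mul (by positivity), ← Real.sqrt_mul (by positivity)]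
        congr 1
        ring
      rw [add_sq, add_sq, Real.sq_sqrt (by positivity), Real.sq_sqrt (by positivity),
        Real.sq_sqrt (by positivity), Real.sq_sqrt (by positivity)]
      linear_combination -2 * hcross
    rw [hsq, ← div_pow, Real.log_pow, Real.log_div hu.ne' hv.ne',
      Real.log_div hu.ne' two_ne_zero, add_comm (Real.sqrt b),
      Real.log_div hv.ne' two_ne_zero]
    have := Real.pi_pos.ne'
    have := (Real.sqrt_pos.2 hab0).ne'
    field_simp
    push_cast
    ring
  · exact (Continuous.log (by fun_prop) fun θ => (hpos θ).ne').intervalIntegrable _ _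
  · exact (Continuous.log (by fun_prop) fun θ =>
      (ha.trans_le (hya θ)).ne').intervalIntegrable _ _
end
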